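/- Consider the saturated closed-loop system on ℝ² (Euclidean norm): Δx_{t+1} = (A − BK)(sat(Δx_t + x*) − x*), where A, B, K are 2×2 real matrices, sat(z) = z/max(‖z‖,1), and ‖x*‖ < 1. If (A − BK)ᵀ(A − BK) − I is negative definite, then for every initial condition Δx₀ ∈ ℝ², the sequence of iterates Δx_t converges to 0 as t → ∞ (equivalently, x_t converges to x*). -/

import Mathlib

open scoped Matrix

/-- Radial saturation onto the unit ball does not increase the distance to a point of the ball. -/
theorem norm_inv_max_smul_sub_le {E : Type*} [NormedAddCommGroup E] [InnerProductSpace ℝ E]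
    {y : E} (hy : ‖y‖ ≤ 1) (z : E) : ‖(max ‖z‖ 1)⁻¹ • z - y‖ ≤ ‖z - y‖ := by
  rcases le_total ‖z‖ 1 with hz | hz
  · simp [max_eq_right hz]
  · rw [max_eq_left hz]
    have hpos : 0 < ‖z‖ := by linarith
    have hinner : inner ℝ z y ≤ ‖z‖ :=
      (real_inner_le_norm z y).trans (mul_le_of_le_one_right hpos.le hy)
    have hsat : ‖‖z‖⁻¹ • z‖ = 1 := by
      rw [norm_smul, norm_inv, norm_norm, inv_mul_cancel₀ hpos.ne']
    have hinv : ‖z‖⁻¹ ≤ 1 := inv_le_one_of_one_le₀ hz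
    have hcancel : ‖z‖⁻¹ * ‖z‖ = 1 := inv_mul_cancel₀ hpos.ne'
    refine le_of_sq_le_sq ?_ (norm_nonneg _)
    rw [norm_sub_sq_real, norm_sub_sq_real, hsat, real_inner_smul_left]
    nlinarith [mul_nonneg (sub_nonneg.2 hinv) (sub_nonneg.2 hinner)]

/-- On a finite-dimensional space, a linear map that strictly shrinks every nonzero vector is a
contraction. -/
theorem LinearMap.exists_norm_le_mul_of_norm_lt {E F : Type*} [NormedAddCommGroup E]
    [NormedSpace ℝ E] [FiniteDimensional ℝ E] [NormedAddCommGroup F] [NormedSpace ℝ F]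
    (T : E →ₗ[ℝ] F) (hT : ∀ v, v ≠ 0 → ‖T v‖ < ‖v‖) :
    ∃ c : ℝ, 0 ≤ c ∧ c < 1 ∧ ∀ v, ‖T v‖ ≤ c * ‖v‖ := by
  rcases subsingleton_or_nontrivial E with _ | _
  · exact ⟨0, le_rfl, one_pos, fun v => by simp [Subsingleton.elim v 0]⟩
  have : ProperSpace E := FiniteDimensional.proper ℝ E
  obtain ⟨w, hw, hmax⟩ := (isCompact_sphere (0 : E) 1).exists_isMaxOn
    (NormedSpace.sphere_nonempty.2 zero_le_one)
    T.continuous_of_finiteDimensional.norm.continuousOn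
  have hw1 : ‖w‖ = 1 := by simpa using hw
  refine ⟨‖T w‖, norm_nonneg _, ?_, fun v => ?_⟩
  · have hw0 : w ≠ 0 := by
      rintro rfl
      simp at hw1
    simpa [hw1] using hT w hw0
  · rcases eq_or_ne v 0 with rfl | hv
    · simp
    have hpos : 0 < ‖v‖ := norm_pos_iff.2 hv
    have hmem : ‖v‖⁻¹ • v ∈ Metric.sphere (0 : E) 1 := by
      simp [norm_smul, hpos.ne']
    have h : ‖T (‖v‖⁻¹ • v)‖ ≤ ‖T w‖ := hmax hmem
    rw [map_smul, norm_smul, norm_inv, norm_norm, inv_mul_eq_div, div_le_iff₀ hpos] at h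
    exact h

/-- If `Mᵀ * M - 1` is negative at `v`, then `M` shrinks the Euclidean norm of `v`. -/
theorem Matrix.norm_toEuclideanLin_lt {n : Type*} [Fintype n] [DecidableEq n]
    (M : Matrix n n ℝ) (v : EuclideanSpace ℝ n)
    (h : v.ofLp ⬝ᵥ ((Mᵀ * M - 1).mulVec v.ofLp) < 0) :
    ‖Matrix.toEuclideanLin M v‖ < ‖v‖ := by
  refine lt_of_pow_lt_pow_left₀ 2 (norm_nonneg _) ?_
  have hsq : ∀ w : EuclideanSpace ℝ n, ‖w‖ ^ 2 = w.ofLp ⬝ᵥ w.ofLp := fun w => by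
    rw [EuclideanSpace.real_norm_sq_eq]
    simp [dotProduct, sq]
  rw [hsq, hsq, Matrix.ofLp_toLpLin, Matrix.toLin'_apply]
  rw [Matrix.sub_mulVec, Matrix.one_mulVec, dotProduct_sub, ← Matrix.mulVec_mulVec,
    Matrix.dotProduct_mulVec, Matrix.vecMul_transpose] at h
  linarith

/-- Convergence (Theorem 1): for the saturated closed-loop system
`Δx_{t+1} = (A - B K) (sat (Δx_t + x*) - x*)` on Euclidean ℝ² with `‖x*‖ < 1` and
`(A - B K)ᵀ (A - B K) - I ≺ 0`, every trajectory converges to `0`. -/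
theorem saturated_closed_loop_converges
    (A B K : Matrix (Fin 2) (Fin 2) ℝ)
    (xstar : EuclideanSpace ℝ (Fin 2)) (hxstar : ‖xstar‖ < 1)
    (sat : EuclideanSpace ℝ (Fin 2) → EuclideanSpace ℝ (Fin 2))
    (hsat : ∀ z, sat z = (max ‖z‖ 1)⁻¹ • z)
    (hK : ∀ z : Fin 2 → ℝ, z ≠ 0 →
      z ⬝ᵥ (((A - B * K)ᵀ * (A - B * K) - 1).mulVec z) < 0)
    (Δx : ℕ → EuclideanSpace ℝ (Fin 2))
    (hstep : ∀ t : ℕ,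
      Δx (t + 1) = Matrix.toEuclideanLin (A - B * K) (sat (Δx t + xstar) - xstar)) :
    Filter.Tendsto Δx Filter.atTop (nhds 0) := by
  obtain ⟨c, hc0, hc1, hc⟩ := LinearMap.exists_norm_le_mul_of_norm_lt
    (Matrix.toEuclideanLin (A - B * K)) fun v hv =>
      Matrix.norm_toEuclideanLin_lt _ v (hK v.ofLp (by simpa using hv))
  have hcontract : ∀ t, ‖Δx (t + 1)‖ ≤ c * ‖Δx t‖ := fun t => by
    rw [hstep, hsat]
    refine (hc _).trans (mul_le_mul_of_nonneg_left ?_ hc0)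
    simpa using norm_inv_max_smul_sub_le hxstar.le (Δx t + xstar)
  have hbound : ∀ t, ‖Δx t‖ ≤ c ^ t * ‖Δx 0‖ := fun t => by
    induction t with
    | zero => simp
    | succ t ih =>
      calc ‖Δx (t + 1)‖ ≤ c * ‖Δx t‖ := hcontract t
        _ ≤ c * (c ^ t * ‖Δx 0‖) := mul_le_mul_of_nonneg_left ih hc0
        _ = c ^ (t + 1) * ‖Δx 0‖ := by ring
  refine squeeze_zero_norm hbound ?_
  simpa using (tendsto_pow_atTop_nhds_zero_of_lt_one hc0 hc1).mul_const ‖Δx 0‖
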